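/- arXiv:2106.13796 — 2 statements merged into one kernel-verified Lean document; each statement's English description precedes it below -/
import Mathlib

section
/- Let a, b, c be positive integers with gcd(a,b,c) = 1, with g_1 = gcd(b,c), g_2 = gcd(c,a), g_3 = gcd(a,b), A = a/(g_2 g_3), B = b/(g_3 g_1), C = c/(g_1 g_2), α' = (A+B+C)/2, β' = 2ABC, M' = ⌊((2α'β'−1)² − 4α'²)/(4β') + α'⌋ + 1, γ'_k = ⌊√(β'(k+α') + α'²) − α'⌋ and δ'_k = ⌊√(β'(k−α') + α'²) − α'⌋. Suppose k ≥ M', γ'_k ≠ δ'_k, and the equation Ax + By + Cz = γ'_k has exactly k nonnegative integer solutions. Then the smallest element of R_k(a,b,c) is g_1 g_2 g_3 · γ'_k; that is, h_{=k}(a,b,c) = g_1 g_2 g_3 γ'_k. -/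
/-- `numSol a b c n` is the number of triples `(x, y, z)` of nonnegative integers
satisfying `a*x + b*y + c*z = n`. -/
noncomputable def numSol (a b c n : ℕ) : ℕ :=
  {p : ℕ × ℕ × ℕ | a * p.1 + b * p.2.1 + c * p.2.2 = n}.ncard

open Finset in
/-- The number of solutions of `A x + B y = m` for coprime `A`, `B` (Popoviciu). -/
theorem mul_ncard_two_var {A B m x0 y0 : ℕ} (hAB : Nat.Coprime A B)
    (hx0 : x0 < B) (hy0 : y0 < A) (hx : (B : ℤ) ∣ m - A * x0) (hy : (A : ℤ) ∣ m - B * y0) :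
    (A * B : ℤ) * ({p : ℕ × ℕ | A * p.1 + B * p.2 = m}.ncard : ℤ)
      = m + A * B - A * x0 - B * y0 := by
  have hA : 0 < A := by omega
  have hB : 0 < B := by omega
  have hcop : IsCoprime (A : ℤ) (B : ℤ) := Nat.isCoprime_iff_coprime.2 hAB
  have hd : (A * B : ℤ) ∣ m - A * x0 - B * y0 := by
    apply hcop.mul_dvd
    · rw [sub_right_comm]
      exact dvd_sub hy (dvd_mul_right _ _)
    · exact dvd_sub hx (dvd_mul_right _ _)
  obtain ⟨j, hj⟩ := hd
  have hAB0 : (0 : ℤ) < A * B := by positivity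
  have hj1 : -1 ≤ j := by
    by_contra! h
    have h2 : j ≤ -2 := by omega
    have h3 : (A : ℤ) * (x0 + 1) ≤ A * B := by gcongr; exact_mod_cast hx0
    have h4 : (B : ℤ) * (y0 + 1) ≤ B * A := by gcongr; exact_mod_cast hy0
    have h5 : (A * B : ℤ) * j ≤ A * B * (-2) := by gcongr
    have h6 : (0 : ℤ) < A := by exact_mod_cast hA
    have h7 : (0 : ℤ) < B := by exact_mod_cast hB
    nlinarith
  obtain ⟨J, hJ⟩ : ∃ J : ℕ, (J : ℤ) = j + 1 := ⟨(j + 1).toNat, by omega⟩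
  have hset : {p : ℕ × ℕ | A * p.1 + B * p.2 = m}
      = (fun i : ℕ => (x0 + B * i, y0 + A * (J - 1 - i))) '' (range J : Set ℕ) := by
    ext ⟨x, y⟩
    simp only [Set.mem_ofPred_eq, Set.mem_image, Finset.mem_coe, Finset.mem_range, Prod.mk.injEq]
    constructor
    · intro h
      have h' : (A : ℤ) * x + B * y = m := by exact_mod_cast h
      have e1 : (B : ℤ) ∣ (x : ℤ) - x0 := by
        apply hcop.symm.dvd_of_dvd_mul_left
        have : (A : ℤ) * (x - x0) = (m - A * x0) - B * y := by rw [← h']; ring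
        rw [this]
        exact dvd_sub hx (dvd_mul_right _ _)
      have e2 : (A : ℤ) ∣ (y : ℤ) - y0 := by
        apply hcop.dvd_of_dvd_mul_left
        have : (B : ℤ) * (y - y0) = (m - B * y0) - A * x := by rw [← h']; ring
        rw [this]
        exact dvd_sub hy (dvd_mul_right _ _)
      obtain ⟨i, hi⟩ := e1
      obtain ⟨l, hl⟩ := e2
      have hi0 : 0 ≤ i := by
        by_contra! h
        have : (B : ℤ) * i ≤ B * (-1) := by gcongr; omega
        omega
      have hl0 : 0 ≤ l := by
        by_contra! h
        have : (A : ℤ) * l ≤ A * (-1) := by gcongr; omega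
        omega
      have hil : i + l = j := by
        apply mul_left_cancel₀ hAB0.ne'
        rw [← hj, ← h']
        linear_combination (-A : ℤ) * hi - (B : ℤ) * hl
      lift i to ℕ using hi0
      lift l to ℕ using hl0
      refine ⟨i, by omega, ?_, ?_⟩
      · have : (x : ℤ) = x0 + B * i := by linarith
        exact_mod_cast this.symm
      · have : J - 1 - i = l := by omega
        rw [this]
        have : (y : ℤ) = y0 + A * l := by linarith
        exact_mod_cast this.symm
    · rintro ⟨i, hi, rfl, rfl⟩
      obtain ⟨l, hl⟩ : ∃ l : ℕ, J - 1 - i = l := ⟨_, rfl⟩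
      rw [hl]
      have : j = i + l := by omega
      subst this
      zify
      linear_combination (-1 : ℤ) * hj
  have hinj : Set.InjOn (fun i : ℕ => (x0 + B * i, y0 + A * (J - 1 - i))) (range J : Set ℕ) := by
    intro i _ i' _ h
    simp only [Prod.mk.injEq] at h
    exact Nat.eq_of_mul_eq_mul_left hB (by omega)
  rw [hset, hinj.ncard_image, Set.ncard_coe_finset, card_range, hJ]
  linear_combination (-1 : ℤ) * hj

open Finset in
/-- A sequence of residues modulo `B` that takes distinct values on any `B` consecutive indices
has partial sums that are not much smaller than those of its mean value. -/
theorem le_sum_of_distinct_residues {B : ℕ} (L : ℕ) : ∀ w : ℕ → ℕ, (∀ z, w z < B) →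
    (∀ z z', w z = w z' → (B : ℤ) ∣ (z : ℤ) - z') →
    4 * (L : ℤ) * (B - 1) - B ^ 2 ≤ 8 * ∑ z ∈ range L, (w z : ℤ) := by
  induction L using Nat.strong_induction_on with
  | _ L ih =>
  intro w hw hinj
  have hB : 0 < B := (Nat.zero_le _).trans_lt (hw 0)
  have hio : ∀ K ≤ B, Set.InjOn w (range K) := by
    intro K hK z hz z' hz' h
    simp only [coe_range, Set.mem_Iio] at hz hz'
    have := Int.eq_zero_of_abs_lt_dvd (hinj z z' h) (by rw [abs_lt]; omega)
    omega
  rcases lt_or_ge L B with hL | hL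
  · have h1 : ∑ i ∈ range L, i ≤ ∑ z ∈ range L, w z := by
      rw [← sum_image (f := fun i => i) (hio L hL.le)]
      have h := Finset.sum_range_le_sum (s := ((range L).image w).image (Nat.cast : ℕ → ℤ)) (c := 0)
        (by simp)
      rw [sum_image Nat.cast_injective.injOn, card_image_of_injective _ Nat.cast_injective,
        card_image_of_injOn (hio L hL.le), card_range] at h
      simp only [zero_add] at h
      rw [← Nat.cast_sum, ← Nat.cast_sum] at h
      exact Nat.cast_le.1 h
    have h2 : (∑ i ∈ range L, (i : ℤ)) * 2 = L * (L - 1) := by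
      have := Finset.sum_range_id_mul_two L
      rcases L with _ | L
      · simp
      · zify at this; simpa using this
    have h3 : ∑ i ∈ range L, (i : ℤ) ≤ ∑ z ∈ range L, (w z : ℤ) := by
      rw [← Nat.cast_sum, ← Nat.cast_sum]
      exact Nat.cast_le.2 h1
    nlinarith [sq_nonneg (2 * (L : ℤ) - B)]
  · obtain ⟨K, rfl⟩ := Nat.exists_eq_add_of_le hL
    have h1 := ih K (by omega) (fun z => w (B + z)) (fun z => hw _) (fun z z' h => by
      have := hinj _ _ h
      push_cast at this
      simpa using this)
    have him : (range B).image w = range B := by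
      apply eq_of_subset_of_card_le
      · intro x hx
        obtain ⟨z, -, rfl⟩ := mem_image.1 hx
        exact mem_range.2 (hw z)
      · rw [card_image_of_injOn (hio B le_rfl)]
    have h2 : (∑ z ∈ range B, (w z : ℤ)) * 2 = B * (B - 1) := by
      have h3 : ∑ z ∈ range B, w z = ∑ i ∈ range B, i := by
        conv_rhs => rw [← him]
        rw [sum_image (hio B le_rfl)]
      have := Finset.sum_range_id_mul_two B
      rw [← h3] at this
      zify [hB] at this
      simpa using this
    rw [sum_range_add]
    push_cast
    nlinarith

open Finset in
theorem sum_le_of_distinct_residues {B : ℕ} (L : ℕ) (w : ℕ → ℕ) (hw : ∀ z, w z < B)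
    (hinj : ∀ z z', w z = w z' → (B : ℤ) ∣ (z : ℤ) - z') :
    8 * ∑ z ∈ range L, (w z : ℤ) ≤ 4 * (L : ℤ) * (B - 1) + B ^ 2 := by
  have h := le_sum_of_distinct_residues L (fun z => B - 1 - w z)
    (fun z => by have := hw z; omega)
    (fun z z' h => hinj z z' (by have := hw z; have := hw z'; omega))
  have e : ∀ z, ((B - 1 - w z : ℕ) : ℤ) = (B - 1) - w z := fun z => by
    have := hw z; omega
  simp only [e, sum_sub_distrib, sum_const, card_range, nsmul_eq_mul] at h
  linarith

theorem exists_residue {A B : ℕ} (hB : 0 < B) (hAB : Nat.Coprime A B) (m : ℤ) :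
    ∃ x < B, (B : ℤ) ∣ m - A * x := by
  obtain ⟨u, v, huv⟩ := Nat.isCoprime_iff_coprime.2 hAB
  have hB' : (0 : ℤ) < B := by exact_mod_cast hB
  refine ⟨(m * u % B).toNat, ?_, ?_⟩
  · have := Int.emod_lt_of_pos (m * u) hB'
    omega
  · rw [Int.toNat_of_nonneg (Int.emod_nonneg _ hB'.ne')]
    refine ⟨m * v + A * (m * u / B), ?_⟩
    linear_combination (-m) * huv + (-A : ℤ) * Int.emod_add_mul_ediv (m * u) B

open Finset in
theorem numSol_eq_sum {A B C : ℕ} (hA : 0 < A) (hB : 0 < B) (hC : 0 < C) (n : ℕ) :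
    numSol A B C n = ∑ z ∈ range (n / C + 1),
      {p : ℕ × ℕ | A * p.1 + B * p.2 = n - C * z}.ncard := by
  have hfin : ∀ m, {p : ℕ × ℕ | A * p.1 + B * p.2 = m}.Finite := by
    intro m
    apply ((Set.finite_Iic m).prod (Set.finite_Iic m)).subset
    rintro ⟨x, y⟩ h
    simp only [Set.mem_ofPred_eq] at h
    simp only [Set.mem_prod, Set.mem_Iic]
    constructor <;> nlinarith
  have hz : ∀ z, z ∈ range (n / C + 1) ↔ C * z ≤ n := by
    intro z
    rw [mem_range, Nat.lt_succ_iff, Nat.le_div_iff_mul_le hC, mul_comm]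
  rw [numSol]
  have : {p : ℕ × ℕ × ℕ | A * p.1 + B * p.2.1 + C * p.2.2 = n}
      = (fun q : (_ : ℕ) × (ℕ × ℕ) => (q.2.1, q.2.2, q.1)) ''
        ((range (n / C + 1)).sigma (fun z => (hfin (n - C * z)).toFinset) : Set _) := by
    ext ⟨x, y, z⟩
    simp only [Set.mem_ofPred_eq, Set.mem_image, Finset.mem_coe, Finset.mem_sigma,
      Set.Finite.mem_toFinset, Prod.mk.injEq, hz]
    constructor
    · intro h
      exact ⟨⟨z, x, y⟩, ⟨by dsimp only; omega, by dsimp only; omega⟩, rfl, rfl, rfl⟩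
    · rintro ⟨⟨z, x, y⟩, ⟨h1, h2⟩, rfl, rfl, rfl⟩
      dsimp only at *
      omega
  rw [this, Set.ncard_image_of_injective, Set.ncard_coe_finset, card_sigma]
  · exact sum_congr rfl fun z _ => (Set.ncard_eq_toFinset_card _ _).symm
  · rintro ⟨z, x, y⟩ ⟨z', x', y'⟩ h
    simp only [Prod.mk.injEq] at h
    obtain ⟨rfl, rfl, rfl⟩ := h
    rfl

open Finset in
/-- The number of solutions differs from its leading quadratic part
`n (n + A + B + C) / (2 A B C)` by less than `(A + B + C) / 2`. -/
theorem numSol_bounds {A B C : ℕ} (hA : 0 < A) (hB : 0 < B) (hC : 0 < C)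
    (hAB : Nat.Coprime A B) (hAC : Nat.Coprime A C) (hBC : Nat.Coprime B C) (n : ℕ) :
    (n : ℤ) * (n + A + B + C) - A * B * C * (A + B + C) ≤ 2 * A * B * C * numSol A B C n ∧
    2 * A * B * C * (numSol A B C n : ℤ) < n * (n + A + B + C) + A * B * C * (A + B + C) := by
  choose w hw hwd using fun z : ℕ => exists_residue hB hAB ((n : ℤ) - C * z)
  choose v hv hvd using fun z : ℕ => exists_residue hA hAB.symm ((n : ℤ) - C * z)
  have hwi : ∀ z z', w z = w z' → (B : ℤ) ∣ (z : ℤ) - z' := by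
    intro z z' h
    apply (Nat.isCoprime_iff_coprime.2 hBC).dvd_of_dvd_mul_left
    have h1 := dvd_sub (hwd z') (hwd z)
    rw [h] at h1
    convert h1 using 1
    ring
  have hvi : ∀ z z', v z = v z' → (A : ℤ) ∣ (z : ℤ) - z' := by
    intro z z' h
    apply (Nat.isCoprime_iff_coprime.2 hAC).dvd_of_dvd_mul_left
    have h1 := dvd_sub (hvd z') (hvd z)
    rw [h] at h1
    convert h1 using 1
    ring
  have hsum : (A * B : ℤ) * numSol A B C n = ∑ z ∈ range (n / C + 1),
      ((n : ℤ) - C * z + A * B - A * w z - B * v z) := by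
    rw [numSol_eq_sum hA hB hC]
    push_cast
    rw [mul_sum]
    refine sum_congr rfl fun z hz => ?_
    have hz' : C * z ≤ n := by
      rw [mem_range, Nat.lt_succ_iff, Nat.le_div_iff_mul_le hC] at hz
      linarith
    have e : ((n - C * z : ℕ) : ℤ) = n - C * z := by push_cast [hz']; ring
    rw [mul_ncard_two_var hAB (hw z) (hv z) (by rw [e]; exact hwd z) (by rw [e]; exact hvd z), e]
  have hw1 := le_sum_of_distinct_residues (n / C + 1) w hw hwi
  have hw2 := sum_le_of_distinct_residues (n / C + 1) w hw hwi
  have hv1 := le_sum_of_distinct_residues (n / C + 1) v hv hvi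
  have hv2 := sum_le_of_distinct_residues (n / C + 1) v hv hvi
  have hid : (∑ i ∈ range (n / C + 1), (i : ℤ)) * 2 = ((n / C + 1 : ℕ) : ℤ) * (n / C : ℕ) := by
    have := Finset.sum_range_id_mul_two (n / C + 1)
    rw [Nat.add_sub_cancel] at this
    rw [← Nat.cast_sum]
    exact_mod_cast this
  have hn := Nat.div_add_mod n C
  have hr := Nat.mod_lt n hC
  simp only [sum_add_distrib, sum_sub_distrib, sum_const, card_range, nsmul_eq_mul,
    ← mul_sum] at hsum
  generalize n / C = Z at *
  generalize n % C = r at *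
  generalize ∑ z ∈ range (Z + 1), (w z : ℤ) = W at *
  generalize ∑ z ∈ range (Z + 1), (v z : ℤ) = V at *
  generalize ∑ z ∈ range (Z + 1), (z : ℤ) = I at *
  generalize numSol A B C n = N at *
  clear hw hwd hv hvd hwi hvi hAB hAC hBC w v
  zify at *
  generalize (A : ℤ) = A at *
  generalize (B : ℤ) = B at *
  generalize (C : ℤ) = C at *
  generalize (N : ℤ) = N at *
  have hr0 : (0 : ℤ) ≤ r := by positivity
  generalize (r : ℤ) = r at *
  generalize (Z : ℤ) = Z at *
  generalize (n : ℤ) = n at *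
  subst hn
  have key : 2 * A * B * C * N = (C * Z + r) * (C * Z + r + A + B + C) + (C - r) * (r + A + B)
      - A * C * (2 * W - (Z + 1) * (B - 1)) - B * C * (2 * V - (Z + 1) * (A - 1)) := by
    linear_combination 2 * C * hsum - C ^ 2 * hid
  have hAC : 0 < A * C := by positivity
  have hBC : 0 < B * C := by positivity
  have t1 := mul_le_mul_of_nonneg_left hw1 hAC.le
  have t2 := mul_le_mul_of_nonneg_left hw2 hAC.le
  have t3 := mul_le_mul_of_nonneg_left hv1 hBC.le
  have t4 := mul_le_mul_of_nonneg_left hv2 hBC.le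
  have hABC : 0 < A * B * C := by positivity
  constructor
  · have p1 : 0 ≤ (C - r) * (r + A + B) := mul_nonneg (by linarith) (by linarith)
    nlinarith [mul_pos hABC hA, mul_pos hABC hB, mul_pos hABC hC]
  · have p1 : (C - r) * (r + A + B) ≤ C * (A + B + C - 1) :=
      mul_le_mul (by linarith) (by linarith) (by linarith) (by linarith)
    have p2 : 4 * (C * (A + B + C - 1)) + A * B * C * (A + B)
        < 4 * (A * B * C * (A + B + C)) := by
      have : 4 * (A + B + C - 1) + A * B * (A + B) < 4 * (A * B * (A + B + C)) := by
        rcases (show A * B = 1 ∨ 2 ≤ A * B by have := mul_pos hA hB; omega) with h | h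
        · have hA1 : A = 1 := Int.eq_one_of_mul_eq_one_right hA.le h
          have hB1 : B = 1 := by rwa [hA1, one_mul] at h
          subst hA1 hB1
          linarith
        · nlinarith
      nlinarith
    nlinarith

/-- Reduction to pairwise coprime coefficients. -/
theorem numSol_reduce {a b c A B C g1 g2 g3 : ℕ} (ha : a = A * (g2 * g3))
    (hb : b = B * (g3 * g1)) (hc : c = C * (g1 * g2)) (h1 : Nat.Coprime a g1)
    (h2 : Nat.Coprime b g2) (h3 : Nat.Coprime c g3) {x0 y0 z0 : ℕ}
    (hx : x0 < g1) (hy : y0 < g2) (hz : z0 < g3) (s : ℕ) :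
    numSol a b c (a * x0 + b * y0 + c * z0 + g1 * g2 * g3 * s) = numSol A B C s := by
  have hg : 0 < g1 * g2 * g3 :=
    Nat.mul_pos (Nat.mul_pos (by omega) (by omega)) (by omega)
  have residue : ∀ {d g x x0 : ℕ}, Nat.Coprime d g → x0 < g → d * x ≡ d * x0 [MOD g] →
      ∃ q, x = x0 + g * q := by
    intro d g x x0 hd hlt h
    have h' := Nat.ModEq.cancel_left_of_coprime hd.symm h
    refine ⟨x / g, ?_⟩
    have e : x % g = x0 := by rw [h', Nat.mod_eq_of_lt hlt]
    have := Nat.mod_add_div x g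
    rw [e] at this
    exact this.symm
  unfold numSol
  have : {p : ℕ × ℕ × ℕ | a * p.1 + b * p.2.1 + c * p.2.2
        = a * x0 + b * y0 + c * z0 + g1 * g2 * g3 * s}
      = (fun p : ℕ × ℕ × ℕ => (x0 + g1 * p.1, y0 + g2 * p.2.1, z0 + g3 * p.2.2)) ''
        {p : ℕ × ℕ × ℕ | A * p.1 + B * p.2.1 + C * p.2.2 = s} := by
    have main : ∀ x y z : ℕ, a * (x0 + g1 * x) + b * (y0 + g2 * y) + c * (z0 + g3 * z)
        = a * x0 + b * y0 + c * z0 + g1 * g2 * g3 * (A * x + B * y + C * z) := by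
      intro x y z
      subst ha hb hc
      ring
    ext ⟨x, y, z⟩
    simp only [Set.mem_ofPred_eq, Set.mem_image, Prod.mk.injEq, Prod.exists]
    constructor
    · intro h
      have hh : (a : ℤ) * x + b * y + c * z
        = a * x0 + b * y0 + c * z0 + g1 * g2 * g3 * s := by exact_mod_cast h
      obtain ⟨x', rfl⟩ : ∃ q, x = x0 + g1 * q := by
        refine residue h1 hx ((Nat.modEq_iff_dvd).2 ?_)
        refine ⟨B * g3 * y + C * g2 * z - B * g3 * y0 - C * g2 * z0 - g2 * g3 * s, ?_⟩
        subst hb hc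
        push_cast at *
        linear_combination (-1 : ℤ) * hh
      obtain ⟨y', rfl⟩ : ∃ q, y = y0 + g2 * q := by
        refine residue h2 hy ((Nat.modEq_iff_dvd).2 ?_)
        refine ⟨A * g3 * (x0 + g1 * x') + C * g1 * z - A * g3 * x0 - C * g1 * z0 - g1 * g3 * s, ?_⟩
        subst ha hc
        push_cast at *
        linear_combination (-1 : ℤ) * hh
      obtain ⟨z', rfl⟩ : ∃ q, z = z0 + g3 * q := by
        refine residue h3 hz ((Nat.modEq_iff_dvd).2 ?_)
        refine ⟨A * g2 * (x0 + g1 * x') + B * g1 * (y0 + g2 * y') - A * g2 * x0 - B * g1 * y0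
          - g1 * g2 * s, ?_⟩
        subst ha hb
        push_cast at *
        linear_combination (-1 : ℤ) * hh
      refine ⟨x', y', z', ?_, rfl, rfl, rfl⟩
      rw [main] at h
      exact Nat.eq_of_mul_eq_mul_left hg (by omega)
    · rintro ⟨x', y', z', h, rfl, rfl, rfl⟩
      rw [main, h]
  rw [this, Set.ncard_image_of_injective]
  rintro ⟨x, y, z⟩ ⟨x', y', z'⟩ h
  simp only [Prod.mk.injEq, Nat.add_left_cancel_iff] at h
  obtain ⟨e1, e2, e3⟩ := h
  rw [Nat.eq_of_mul_eq_mul_left (by omega) e1, Nat.eq_of_mul_eq_mul_left (by omega) e2,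
    Nat.eq_of_mul_eq_mul_left (by omega) e3]

/-- If a quantity close to `n (n + 2 α) / β` takes the value `k`, and `k` is large, then `n`
is determined by `k`. -/
theorem eq_floor_of_bounds {α β κ : ℝ} (hα : 3 / 2 ≤ α) (hβ : 2 ≤ β)
    (hκ : ((2 * α * β - 1) ^ 2 - 4 * α ^ 2) / (4 * β) + α < κ) {γ δ : ℤ}
    (hγ : γ = ⌊Real.sqrt (β * (κ + α) + α ^ 2) - α⌋)
    (hδ : δ = ⌊Real.sqrt (β * (κ - α) + α ^ 2) - α⌋) :
    0 < κ ∧ 0 ≤ γ ∧ (γ ≠ δ → ∀ n : ℕ, (n : ℝ) * (n + 2 * α) - α * β ≤ β * κ →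
      β * κ < n * (n + 2 * α) + α * β → (n : ℤ) = γ) := by
  have h1 : (2 * α * β - 1) ^ 2 - 4 * α ^ 2 < (κ - α) * (4 * β) := by
    rw [← div_lt_iff₀ (by linarith)]
    linarith
  have hαβ : 2 * α ≤ α * β := by nlinarith
  have hpos : 0 ≤ (2 * α * β - 1) ^ 2 - 4 * α ^ 2 := by nlinarith
  have hκα : 0 < κ - α := by
    by_contra! h
    nlinarith
  have hD : 0 ≤ β * (κ - α) + α ^ 2 := by positivity
  have hG : 0 ≤ β * (κ + α) + α ^ 2 := by nlinarith
  have sD := Real.sq_sqrt hD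
  have sG := Real.sq_sqrt hG
  have pD := Real.sqrt_nonneg (β * (κ - α) + α ^ 2)
  have pG := Real.sqrt_nonneg (β * (κ + α) + α ^ 2)
  generalize Real.sqrt (β * (κ - α) + α ^ 2) = SD at *
  generalize Real.sqrt (β * (κ + α) + α ^ 2) = SG at *
  have bD : (2 * α * β - 1) / 2 < SD := by
    apply lt_of_pow_lt_pow_left₀ 2 pD
    rw [sD]
    nlinarith
  have bG : (2 * α * β + 1) / 2 < SG := by
    apply lt_of_pow_lt_pow_left₀ 2 pG
    rw [sG]
    nlinarith
  have gap : SG - SD < 1 := by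
    by_contra! h
    nlinarith
  have hle : SD ≤ SG := by
    apply le_of_sq_le_sq _ pG
    nlinarith
  refine ⟨by linarith, ?_, ?_⟩
  · rw [hγ, Int.floor_nonneg]
    nlinarith
  · intro hne n hn1 hn2
    have hn0 : (0 : ℝ) ≤ n := by positivity
    have u : (n : ℝ) + α ≤ SG := by
      apply le_of_sq_le_sq _ pG
      rw [sG]
      nlinarith
    have l : SD < n + α := by
      apply lt_of_pow_lt_pow_left₀ 2 (by linarith)
      rw [sD]
      nlinarith
    have u' : (n : ℤ) ≤ γ := by
      rw [hγ, Int.le_floor]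
      push_cast
      linarith
    have l' : δ < n := by
      rw [hδ, Int.floor_lt]
      push_cast
      linarith
    have g' : γ < δ + 2 := by
      rw [hγ, Int.floor_lt]
      have := Int.lt_floor_add_one (SD - α)
      rw [← hδ] at this
      push_cast
      linarith
    omega

theorem stmt_12 (a b c : ℕ)
    (ha : 0 < a) (hb : 0 < b) (hc : 0 < c)
    (habc : Nat.gcd (Nat.gcd a b) c = 1)
    (g1 g2 g3 : ℕ) (hg1 : g1 = Nat.gcd b c) (hg2 : g2 = Nat.gcd c a)
    (hg3 : g3 = Nat.gcd a b)
    (A B C : ℕ) (hA : A = a / (g2 * g3)) (hB : B = b / (g3 * g1))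
    (hC : C = c / (g1 * g2))
    (α β : ℝ) (hα : α = ((A : ℝ) + B + C) / 2) (hβ : β = 2 * A * B * C)
    (M : ℤ) (hM : M = ⌊((2 * α * β - 1) ^ 2 - 4 * α ^ 2) / (4 * β) + α⌋ + 1)
    (k : ℕ)
    (γ δ : ℤ)
    (hγ : γ = ⌊Real.sqrt (β * ((k : ℝ) + α) + α ^ 2) - α⌋)
    (hδ : δ = ⌊Real.sqrt (β * ((k : ℝ) - α) + α ^ 2) - α⌋)
    (hk : M ≤ (k : ℤ)) (hγδ : γ ≠ δ)
    (hsol : {p : ℕ × ℕ × ℕ |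
      (A : ℤ) * p.1 + (B : ℤ) * p.2.1 + (C : ℤ) * p.2.2 = γ}.ncard = k) :
    IsLeast ((fun t : ℕ => (t : ℤ)) '' {t : ℕ | numSol a b c t = k})
      ((g1 : ℤ) * g2 * g3 * γ) := by
  have d2 : g2 ∣ a := hg2 ▸ Nat.gcd_dvd_right c a
  have d2' : g2 ∣ c := hg2 ▸ Nat.gcd_dvd_left c a
  have d3 : g3 ∣ a := hg3 ▸ Nat.gcd_dvd_left a b
  have d3' : g3 ∣ b := hg3 ▸ Nat.gcd_dvd_right a b
  have d1 : g1 ∣ b := hg1 ▸ Nat.gcd_dvd_left b c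
  have d1' : g1 ∣ c := hg1 ▸ Nat.gcd_dvd_right b c
  have g1p : 0 < g1 := Nat.pos_of_dvd_of_pos d1 hb
  have g2p : 0 < g2 := Nat.pos_of_dvd_of_pos d2 ha
  have g3p : 0 < g3 := Nat.pos_of_dvd_of_pos d3 ha
  have c1 : Nat.Coprime a g1 := by
    rw [hg1, Nat.Coprime, ← Nat.gcd_assoc, habc]
  have c2 : Nat.Coprime b g2 := by
    rw [hg2, Nat.Coprime, Nat.gcd_comm c a, ← Nat.gcd_assoc, Nat.gcd_comm b a, habc]
  have c3 : Nat.Coprime c g3 := by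
    rw [hg3, Nat.Coprime, Nat.gcd_comm, habc]
  have ea : a = A * (g2 * g3) := by
    rw [hA, Nat.div_mul_cancel]
    exact (c2.coprime_dvd_left d3').symm.mul_dvd_of_dvd_of_dvd d2 d3
  have eb : b = B * (g3 * g1) := by
    rw [hB, Nat.div_mul_cancel]
    exact (c3.coprime_dvd_left d1').symm.mul_dvd_of_dvd_of_dvd d3' d1
  have ec : c = C * (g1 * g2) := by
    rw [hC, Nat.div_mul_cancel]
    exact (c1.coprime_dvd_left d2).symm.mul_dvd_of_dvd_of_dvd d1' d2'
  have coprime_of : ∀ {X Y p q g : ℕ}, 0 < g → g = Nat.gcd (X * p * g) (Y * q * g) →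
      Nat.Coprime X Y := by
    intro X Y p q g hg h
    rw [Nat.gcd_mul_right] at h
    have : Nat.gcd (X * p) (Y * q) = 1 :=
      Nat.eq_of_mul_eq_mul_right hg (by omega)
    exact Nat.Coprime.coprime_mul_right (Nat.Coprime.coprime_mul_right_right this)
  have hAB : Nat.Coprime A B := by
    refine coprime_of (p := g2) (q := g1) g3p ?_
    conv_lhs => rw [hg3, ea, eb]
    congr 1 <;> ring
  have hBC : Nat.Coprime B C := by
    refine coprime_of (p := g3) (q := g2) g1p ?_
    conv_lhs => rw [hg1, eb, ec]
    congr 1 <;> ring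
  have hCA : Nat.Coprime C A := by
    refine coprime_of (p := g1) (q := g3) g2p ?_
    conv_lhs => rw [hg2, ec, ea]
    congr 1 <;> ring
  have hA0 : 0 < A := Nat.pos_of_ne_zero (by rintro rfl; simp at ea; omega)
  have hB0 : 0 < B := Nat.pos_of_ne_zero (by rintro rfl; simp at eb; omega)
  have hC0 : 0 < C := Nat.pos_of_ne_zero (by rintro rfl; simp at ec; omega)
  have hα1 : 3 / 2 ≤ α := by
    have : (3 : ℝ) ≤ A + B + C := by norm_cast; omega
    linarith
  have hβ1 : 2 ≤ β := by
    have : (1 : ℝ) ≤ A * B * C := by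
      norm_cast
      exact Nat.succ_le_of_lt (Nat.mul_pos (Nat.mul_pos hA0 hB0) hC0)
    rw [hβ]; linarith
  have hκ : ((2 * α * β - 1) ^ 2 - 4 * α ^ 2) / (4 * β) + α < k := by
    have h1 := Int.lt_floor_add_one (((2 * α * β - 1) ^ 2 - 4 * α ^ 2) / (4 * β) + α)
    have h2 : (M : ℝ) ≤ k := by exact_mod_cast hk
    rw [hM] at h2
    push_cast at h2
    linarith
  obtain ⟨hk0, hγ0, huniq⟩ := eq_floor_of_bounds hα1 hβ1 hκ hγ hδ
  have hk0' : 0 < k := by exact_mod_cast hk0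
  obtain ⟨s, hs⟩ := Int.eq_ofNat_of_zero_le hγ0
  have hs' : numSol A B C s = k := by
    rw [← hsol, numSol, hs]
    congr 1
    ext p
    simp only [Set.mem_ofPred_eq]
    exact_mod_cast Iff.rfl
  have huniq' : ∀ n, numSol A B C n = k → n = s := by
    intro n hn
    obtain ⟨l, u⟩ := numSol_bounds hA0 hB0 hC0 hAB hCA.symm hBC n
    rw [hn] at l u
    have l' : (n : ℝ) * (n + A + B + C) - A * B * C * (A + B + C) ≤ 2 * A * B * C * k := by
      exact_mod_cast l
    have u' : 2 * A * B * C * (k : ℝ) < n * (n + A + B + C) + A * B * C * (A + B + C) := by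
      exact_mod_cast u
    have := huniq hγδ n (by rw [hα, hβ]; linarith) (by rw [hα, hβ]; linarith)
    omega
  rw [hs]
  constructor
  · refine ⟨g1 * g2 * g3 * s, ?_, by push_cast; rfl⟩
    have := numSol_reduce ea eb ec c1 c2 c3 g1p g2p g3p s
    simpa [hs'] using this
  · rintro _ ⟨t, ht, rfl⟩
    simp only [Set.mem_ofPred_eq] at ht
    obtain ⟨⟨x, y, z⟩, hp⟩ : {p : ℕ × ℕ × ℕ | a * p.1 + b * p.2.1 + c * p.2.2 = t}.Nonempty :=
      Set.nonempty_of_ncard_ne_zero (by rw [← numSol, ht]; omega)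
    simp only [Set.mem_ofPred_eq] at hp
    have et : t = a * (x % g1) + b * (y % g2) + c * (z % g3)
        + g1 * g2 * g3 * (A * (x / g1) + B * (y / g2) + C * (z / g3)) := by
      rw [← hp]
      conv_lhs => rw [← Nat.mod_add_div x g1, ← Nat.mod_add_div y g2, ← Nat.mod_add_div z g3]
      nth_rewrite 1 [mul_add, mul_add, mul_add]
      have e1 : a * (g1 * (x / g1)) = g1 * g2 * g3 * (A * (x / g1)) := by
        rw [ea]; ring
      have e2 : b * (g2 * (y / g2)) = g1 * g2 * g3 * (B * (y / g2)) := by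
        rw [eb]; ring
      have e3 : c * (g3 * (z / g3)) = g1 * g2 * g3 * (C * (z / g3)) := by
        rw [ec]; ring
      rw [e1, e2, e3]
      ring
    have hred := numSol_reduce ea eb ec c1 c2 c3 (Nat.mod_lt x g1p) (Nat.mod_lt y g2p)
      (Nat.mod_lt z g3p) (A * (x / g1) + B * (y / g2) + C * (z / g3))
    rw [← et, ht] at hred
    have hss := huniq' _ hred.symm
    rw [hss] at et
    have : g1 * g2 * g3 * s ≤ t := by omega
    dsimp only
    exact_mod_cast this
end

section
/- Let a, b, c be positive integers with gcd(a,b,c) = 1, with g_1 = gcd(b,c), g_2 = gcd(c,a), g_3 = gcd(a,b), A = a/(g_2 g_3), B = b/(g_3 g_1), C = c/(g_1 g_2), α' = (A+B+C)/2, β' = 2ABC, M' = ⌊((2α'β'−1)² − 4α'²)/(4β') + α'⌋ + 1, γ'_k = ⌊√(β'(k+α') + α'²) − α'⌋ and δ'_k = ⌊√(β'(k−α') + α'²) − α'⌋. If k ≥ M' and γ'_k = δ'_k, then there is no nonnegative integer n such that ax + by + cz = n has exactly k nonnegative integer solutions; that is, R_k(a,b,c) = ∅. -/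
open Finset in
/-- A partial sum of a periodic sequence with vanishing sum over a period is bounded by the
trivial bound for an incomplete period. -/
theorem abs_sum_range_le_of_periodic (f : ℕ → ℝ) (d : ℕ) (hd : 0 < d) (K : ℝ)
    (hper : ∀ j, f (j + d) = f j) (hsum : ∑ j ∈ range d, f j = 0) (hbd : ∀ j, |f j| ≤ K)
    (n : ℕ) : |∑ j ∈ range n, f j| ≤ ((d : ℝ) - 1) * K := by
  induction n using Nat.strong_induction_on with
  | _ n ih =>
    have hK : 0 ≤ K := (abs_nonneg _).trans (hbd 0)
    by_cases h : n < d
    · calc |∑ j ∈ range n, f j| ≤ ∑ j ∈ range n, |f j| := abs_sum_le_sum_abs _ _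
        _ ≤ ∑ _j ∈ range n, K := sum_le_sum fun j _ => hbd j
        _ = n * K := by simp
        _ ≤ ((d : ℝ) - 1) * K := by
          have : (n : ℝ) + 1 ≤ d := by exact_mod_cast h
          gcongr
          linarith
    · obtain ⟨m, rfl⟩ := Nat.exists_eq_add_of_le (not_lt.mp h)
      rw [sum_range_add, hsum, zero_add, sum_congr rfl fun j _ => by rw [add_comm d j, hper]]
      exact ih m (by omega)

theorem ZMod.sum_val (d : ℕ) [NeZero d] :
    ∑ x : ZMod d, (x.val : ℝ) = d * ((d : ℝ) - 1) / 2 := by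
  cases d with
  | zero => exact absurd rfl (NeZero.ne 0)
  | succ d =>
    refine (Fin.sum_univ_eq_sum_range (fun j => (j : ℝ)) (d + 1)).trans ?_
    induction d with
    | zero => simp
    | succ d ih => rw [Finset.sum_range_succ, ih]; push_cast; ring

/-- The least residue of `m / a` modulo `d`. -/
def quotResidue (a d m : ℕ) : ℕ := ((m : ZMod d) * (a : ZMod d)⁻¹).val

theorem quotResidue_lt (a d m : ℕ) (hd : 0 < d) : quotResidue a d m < d :=
  have : NeZero d := ⟨hd.ne'⟩
  ZMod.val_lt _

theorem mul_quotResidue_modEq (a d m : ℕ) (hd : 0 < d) (h : Nat.Coprime a d) :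
    a * quotResidue a d m ≡ m [MOD d] := by
  have : NeZero d := ⟨hd.ne'⟩
  rw [← ZMod.natCast_eq_natCast_iff]
  have := ZMod.coe_mul_inv_eq_one a h
  simp only [quotResidue, Nat.cast_mul, ZMod.natCast_val, ZMod.cast_id', id]
  linear_combination (m : ZMod d) * this

open Finset in
theorem sum_range_quotResidue (a c d r : ℕ) (hd : 0 < d) (ha : Nat.Coprime a d)
    (hc : Nat.Coprime c d) :
    ∑ j ∈ range d, (quotResidue a d (r + c * j) : ℝ) = d * ((d : ℝ) - 1) / 2 := by
  have : NeZero d := ⟨hd.ne'⟩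
  rw [← ZMod.sum_val d]
  have h1 := ZMod.coe_mul_inv_eq_one a ha
  have h2 := ZMod.coe_mul_inv_eq_one c hc
  refine sum_bij' (fun j _ => ((r + c * j : ℕ) : ZMod d) * (a : ZMod d)⁻¹)
    (fun x _ => ((x * a - r) * (c : ZMod d)⁻¹).val) (by simp)
    (fun x _ => mem_range.mpr (ZMod.val_lt _)) ?_ ?_ (fun _ _ => rfl)
  · intro j hj
    have : (((r + c * j : ℕ) : ZMod d) * (a : ZMod d)⁻¹ * a - r) * (c : ZMod d)⁻¹ = (j : ZMod d) := by
      push_cast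
      linear_combination ((r : ZMod d) + c * j) * (c : ZMod d)⁻¹ * h1 + (j : ZMod d) * h2
    rw [this, ZMod.val_cast_of_lt (mem_range.mp hj)]
  · intro x _
    simp only [Nat.cast_add, Nat.cast_mul, ZMod.natCast_val, ZMod.cast_id', id]
    linear_combination (x * a - r) * (a : ZMod d)⁻¹ * h2 + x * h1

open Finset in
theorem abs_sum_quotResidue_sub_le (a c d r n : ℕ) (hd : 0 < d) (ha : Nat.Coprime a d)
    (hc : Nat.Coprime c d) :
    |∑ j ∈ range n, (quotResidue a d (r + c * j) : ℝ) - n * (((d : ℝ) - 1) / 2)|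
      ≤ ((d : ℝ) - 1) ^ 2 / 2 := by
  have h := abs_sum_range_le_of_periodic
    (fun j => (quotResidue a d (r + c * j) : ℝ) - ((d : ℝ) - 1) / 2) d hd (((d : ℝ) - 1) / 2)
    (fun j => by simp [quotResidue, mul_add])
    (by rw [sum_sub_distrib, sum_range_quotResidue a c d r hd ha hc]; simp; ring)
    (fun j => by
      have : (quotResidue a d (r + c * j) : ℝ) + 1 ≤ d := by
        exact_mod_cast quotResidue_lt a d (r + c * j) hd
      have : (0 : ℝ) ≤ quotResidue a d (r + c * j) := Nat.cast_nonneg _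
      rw [abs_le]
      constructor <;> linarith) n
  rw [sum_sub_distrib] at h
  simp only [sum_const, card_range, nsmul_eq_mul] at h
  linarith

/-- The number of solutions of a linear equation in two unknowns with coprime coefficients. -/
theorem exists_card_two_unknowns (a b m : ℕ) (ha : 0 < a) (hb : 0 < b) (h : Nat.Coprime a b) :
    ∃ t : ℕ, m + a * b = a * quotResidue a b m + b * quotResidue b a m + a * b * t ∧
      {p : ℕ × ℕ | a * p.1 + b * p.2 = m}.ncard = t := by
  have hx := mul_quotResidue_modEq a b m hb h
  have hy := mul_quotResidue_modEq b a m ha h.symm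
  have hxl := quotResidue_lt a b m hb
  have hyl := quotResidue_lt b a m ha
  set x₀ := quotResidue a b m
  set y₀ := quotResidue b a m
  obtain ⟨t, ht⟩ : ∃ t : ℕ, m + a * b = a * x₀ + b * y₀ + a * b * t := by
    have h1 : (a * x₀ + b * y₀) ≡ m + a * b [MOD a * b] := by
      rw [← Nat.modEq_and_modEq_iff_modEq_mul h]
      refine ⟨?_, ?_⟩
      · simpa [Nat.ModEq] using hy
      · simpa [Nat.ModEq] using hx
    obtain ⟨s, hs⟩ := (Nat.modEq_iff_dvd.mp h1)
    have hs0 : 0 ≤ s := by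
      have e1 : (a : ℤ) * x₀ + a ≤ a * b := by exact_mod_cast (by nlinarith : a * x₀ + a ≤ a * b)
      have e2 : (b : ℤ) * y₀ + b ≤ a * b := by exact_mod_cast (by nlinarith : b * y₀ + b ≤ a * b)
      push_cast at hs
      have ha' : (0 : ℤ) < a := by exact_mod_cast ha
      have hb' : (0 : ℤ) < b := by exact_mod_cast hb
      have hab : (0 : ℤ) < a * b := by positivity
      by_contra hneg
      have : s ≤ -1 := by omega
      nlinarith [Int.natCast_nonneg m]
    lift s to ℕ using hs0
    refine ⟨s, ?_⟩
    zify
    push_cast at hs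
    linarith
  refine ⟨t, ht, ?_⟩
  have hset : {p : ℕ × ℕ | a * p.1 + b * p.2 = m}
      = ((Finset.range t).image fun i => (x₀ + b * i, y₀ + a * (t - 1 - i)) : Finset (ℕ × ℕ)) := by
    ext ⟨x, y⟩
    simp only [Set.mem_ofPred_eq, Finset.coe_image, Set.mem_image, Finset.mem_coe,
      Finset.mem_range, Prod.mk.injEq]
    constructor
    · intro hxy
      have hxm : x ≡ x₀ [MOD b] := by
        refine Nat.ModEq.cancel_left_of_coprime (c := a) h.symm ?_
        refine Nat.ModEq.trans ?_ hx.symm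
        simp [← hxy, Nat.ModEq]
      have hym : y ≡ y₀ [MOD a] := by
        refine Nat.ModEq.cancel_left_of_coprime (c := b) h ?_
        refine Nat.ModEq.trans ?_ hy.symm
        simp [← hxy, Nat.ModEq]
      have ex : x = x₀ + b * (x / b) := by
        have : x % b = x₀ := by rw [hxm, Nat.mod_eq_of_lt hxl]
        rw [← this, Nat.mod_add_div]
      have ey : y = y₀ + a * (y / a) := by
        have : y % a = y₀ := by rw [hym, Nat.mod_eq_of_lt hyl]
        rw [← this, Nat.mod_add_div]
      generalize x / b = i at ex
      generalize y / a = j at ey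
      have : a * b * (i + j + 1) = a * b * t := by
        rw [ex, ey] at hxy
        nlinarith
      have hij : i + j + 1 = t := Nat.eq_of_mul_eq_mul_left (by positivity) this
      refine ⟨i, by omega, ex.symm, ?_⟩
      rw [ey, ← hij]
      congr 2
      omega
    · rintro ⟨i, hi, rfl, rfl⟩
      obtain ⟨j, rfl⟩ : ∃ j, t = i + j + 1 := ⟨t - i - 1, by omega⟩
      rw [show i + j + 1 - 1 - i = j by omega]
      nlinarith
  rw [hset, Set.ncard_coe_finset, Finset.card_image_of_injective, Finset.card_range]
  intro i j hij
  have := (Prod.mk.inj hij).1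
  exact Nat.eq_of_mul_eq_mul_left hb (by omega)

theorem finite_two_unknowns (a b m : ℕ) (ha : 0 < a) (hb : 0 < b) :
    {p : ℕ × ℕ | a * p.1 + b * p.2 = m}.Finite := by
  refine ((Set.finite_Iic m).prod (Set.finite_Iic m)).subset ?_
  rintro ⟨x, y⟩ h
  simp only [Set.mem_ofPred_eq] at h
  simp only [Set.mem_prod, Set.mem_Iic]
  constructor <;> nlinarith

open Finset in
theorem numSol_eq_sum_s14 (a b c n : ℕ) (ha : 0 < a) (hb : 0 < b) (hc : 0 < c) :
    numSol a b c n = ∑ j ∈ range (n / c + 1),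
      {p : ℕ × ℕ | a * p.1 + b * p.2 = n % c + c * j}.ncard := by
  have hfin := fun m => finite_two_unknowns a b m ha hb
  have hset : {p : ℕ × ℕ × ℕ | a * p.1 + b * p.2.1 + c * p.2.2 = n}
      = (((range (n / c + 1)).sigma fun j => (hfin (n % c + c * j)).toFinset).image
        (fun s => (s.2.1, s.2.2, n / c - s.1)) : Finset (ℕ × ℕ × ℕ)) := by
    have hn := Nat.mod_add_div n c
    ext ⟨x, y, z⟩
    simp only [Set.mem_ofPred_eq, coe_image, Set.mem_image, mem_coe, mem_sigma, mem_range,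
      Set.Finite.mem_toFinset, Prod.mk.injEq, Sigma.exists, Prod.exists]
    constructor
    · intro h
      have hz : z ≤ n / c := (Nat.le_div_iff_mul_le hc).mpr (by nlinarith)
      obtain ⟨j, hj⟩ := Nat.exists_eq_add_of_le hz
      refine ⟨j, x, y, ⟨by omega, ?_⟩, rfl, rfl, by omega⟩
      rw [hj] at hn
      nlinarith
    · rintro ⟨j, x', y', ⟨hj, h⟩, rfl, rfl, rfl⟩
      obtain ⟨z, hz⟩ := Nat.exists_eq_add_of_le (Nat.lt_succ_iff.mp hj)
      rw [hz] at hn ⊢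
      rw [Nat.add_sub_cancel_left, h]
      nlinarith
  rw [numSol, hset, Set.ncard_coe_finset, card_image_of_injOn, card_sigma]
  · exact sum_congr rfl fun j _ => (Set.ncard_eq_toFinset_card _ (hfin _)).symm
  · rintro ⟨j, x, y⟩ h ⟨j', x', y'⟩ h' e
    simp only [coe_sigma, Set.mem_sigma_iff, mem_coe, mem_range] at h h'
    simp only [Prod.mk.injEq] at e
    obtain ⟨rfl, rfl, e⟩ := e
    obtain rfl : j = j' := by omega
    rfl

open Finset in
theorem abs_numSol_sub_lt (a b c n : ℕ) (ha : 0 < a) (hb : 0 < b) (hc : 0 < c)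
    (hab : Nat.Coprime a b) (hac : Nat.Coprime c a) (hbc : Nat.Coprime c b) :
    |2 * a * b * c * (numSol a b c n : ℝ) - n * (n + (a + b + c))|
      < (a * b * c * (a + b + c) : ℝ) := by
  choose t ht htc using fun j : ℕ => exists_card_two_unknowns a b (n % c + c * j) ha hb hab
  have hN : (numSol a b c n : ℝ) = ∑ j ∈ range (n / c + 1), (t j : ℝ) := by
    rw [numSol_eq_sum_s14 a b c n ha hb hc, sum_congr rfl fun j _ => htc j]
    push_cast
    rfl
  have hx := abs_sum_quotResidue_sub_le a c b (n % c) (n / c + 1) hb hab hbc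
  have hy := abs_sum_quotResidue_sub_le b c a (n % c) (n / c + 1) ha hab.symm hac
  have hj : ∀ Z : ℕ, ∑ j ∈ range (Z + 1), (j : ℝ) = Z * (Z + 1) / 2 := by
    intro Z
    induction Z with
    | zero => simp
    | succ Z ih => rw [sum_range_succ, ih]; push_cast; ring
  have hsum : ∑ j ∈ range (n / c + 1), (((n % c : ℕ) : ℝ) + c * j + a * b)
      = ∑ j ∈ range (n / c + 1), ((a : ℝ) * quotResidue a b (n % c + c * j)
        + b * quotResidue b a (n % c + c * j) + a * b * t j) :=
    sum_congr rfl fun j _ => by exact_mod_cast ht j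
  simp only [sum_add_distrib, ← mul_sum, hj, sum_const, card_range, nsmul_eq_mul, ← hN] at hsum
  have hn : ((n % c : ℕ) : ℝ) + c * (n / c : ℕ) = n := by exact_mod_cast Nat.mod_add_div n c
  have hr : ((n % c : ℕ) : ℝ) < c := by exact_mod_cast Nat.mod_lt n hc
  have hr0 : (0 : ℝ) ≤ (n % c : ℕ) := Nat.cast_nonneg _
  push_cast at hsum hx hy
  generalize ((n % c : ℕ) : ℝ) = r at *
  generalize ((n / c : ℕ) : ℝ) = Z at *
  generalize (numSol a b c n : ℝ) = N at *
  generalize ∑ j ∈ range (n / c + 1), (quotResidue a b (n % c + c * j) : ℝ) = X at *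
  generalize ∑ j ∈ range (n / c + 1), (quotResidue b a (n % c + c * j) : ℝ) = Y at *
  have ha' : (1 : ℝ) ≤ a := by exact_mod_cast ha
  have hb' : (1 : ℝ) ≤ b := by exact_mod_cast hb
  have hc' : (1 : ℝ) ≤ c := by exact_mod_cast hc
  have ha0 : (0 : ℝ) < a := by exact_mod_cast ha
  have hb0 : (0 : ℝ) < b := by exact_mod_cast hb
  have hc0 : (0 : ℝ) < c := by exact_mod_cast hc
  generalize (a : ℝ) = A at *
  generalize (b : ℝ) = B at *
  generalize (c : ℝ) = C at *
  generalize (n : ℝ) = n at *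
  set E := X - (Z + 1) * ((B - 1) / 2) with hE
  set F := Y - (Z + 1) * ((A - 1) / 2) with hF
  have key : 2 * A * B * C * N - n * (n + (A + B + C))
      = (C - r) * (A + B + r) - 2 * A * C * E - 2 * B * C * F := by
    rw [hE, hF, ← hn]
    linear_combination (-2 * C) * hsum
  rw [key]
  have hACE : |2 * A * C * E| ≤ A * C * (B - 1) ^ 2 := by
    rw [abs_mul, abs_of_pos (by positivity)]
    exact (mul_le_mul_of_nonneg_left hx (by positivity)).trans_eq (by ring)
  have hBCF : |2 * B * C * F| ≤ B * C * (A - 1) ^ 2 := by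
    rw [abs_mul, abs_of_pos (by positivity)]
    exact (mul_le_mul_of_nonneg_left hy (by positivity)).trans_eq (by ring)
  have hAB : 1 ≤ A * B := one_le_mul_of_one_le_of_one_le ha' hb'
  have h1 : A * C ≤ A * B * C := by
    rw [mul_right_comm]
    exact le_mul_of_one_le_right (by positivity) hb'
  have h2 : B * C ≤ A * B * C := by
    rw [mul_assoc]
    exact le_mul_of_one_le_left (by positivity) ha'
  have h3 : C ^ 2 ≤ A * B * C ^ 2 := le_mul_of_one_le_left (by positivity) hAB
  have h4 : 0 ≤ (C - r) * (A + B + r) := by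
    apply mul_nonneg <;> linarith
  have h5 : (C - r) * (A + B + r) ≤ C * (A + B) + C ^ 2 / 4 := by
    linarith [sq_nonneg (C - 2 * r), mul_nonneg hr0 (by linarith : 0 ≤ A + B)]
  have h6 : A * C * (B - 1) ^ 2 + B * C * (A - 1) ^ 2
      = A * B * C * (A + B) - 4 * (A * B * C) + A * C + B * C := by ring
  have h7 : 0 < C ^ 2 := by positivity
  rw [abs_le] at hACE hBCF
  rw [abs_lt]
  have h8 : 0 < A * B * C := by positivity
  have h9 : 0 < A * B * C ^ 2 := by positivity
  have h10 : A * B * C * (A + B + C) = A * B * C * (A + B) + A * B * C ^ 2 := by ring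
  rw [h10]
  constructor <;> linarith

/-- Division of the unknowns by the pairwise common factors of the coefficients. -/
theorem exists_numSol_mul_eq (A B C g₁ g₂ g₃ n : ℕ) (h₁ : 0 < g₁) (h₂ : 0 < g₂) (h₃ : 0 < g₃)
    (c₁ : Nat.Coprime g₁ (A * (g₂ * g₃))) (c₂ : Nat.Coprime g₂ (B * (g₃ * g₁)))
    (c₃ : Nat.Coprime g₃ (C * (g₁ * g₂)))
    (hn : numSol (A * (g₂ * g₃)) (B * (g₃ * g₁)) (C * (g₁ * g₂)) n ≠ 0) :
    ∃ m, numSol A B C m = numSol (A * (g₂ * g₃)) (B * (g₃ * g₁)) (C * (g₁ * g₂)) n := by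
  obtain ⟨⟨X, Y, Z⟩, hXYZ⟩ := Set.nonempty_of_ncard_ne_zero hn
  simp only [Set.mem_ofPred_eq] at hXYZ
  have eX := Nat.mod_add_div X g₁
  have eY := Nat.mod_add_div Y g₂
  have eZ := Nat.mod_add_div Z g₃
  refine ⟨A * (X / g₁) + B * (Y / g₂) + C * (Z / g₃), ?_⟩
  have hpos : 0 < g₁ * g₂ * g₃ := by positivity
  refine Set.ncard_congr
    (fun p _ => (X % g₁ + g₁ * p.1, Y % g₂ + g₂ * p.2.1, Z % g₃ + g₃ * p.2.2)) ?_ ?_ ?_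
  · rintro ⟨x, y, z⟩ h
    simp only [Set.mem_ofPred_eq] at h ⊢
    rw [← hXYZ]
    generalize X / g₁ = X', X % g₁ = x₀ at *
    generalize Y / g₂ = Y', Y % g₂ = y₀ at *
    generalize Z / g₃ = Z', Z % g₃ = z₀ at *
    subst eX eY eZ
    zify at h ⊢
    linear_combination (g₁ * g₂ * g₃ : ℤ) * h
  · rintro ⟨x, y, z⟩ ⟨x', y', z'⟩ _ _ h
    simp only [Prod.mk.injEq, add_right_inj] at h ⊢
    exact ⟨Nat.eq_of_mul_eq_mul_left h₁ h.1, Nat.eq_of_mul_eq_mul_left h₂ h.2.1,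
      Nat.eq_of_mul_eq_mul_left h₃ h.2.2⟩
  · rintro ⟨x, y, z⟩ h
    simp only [Set.mem_ofPred_eq] at h
    have hx : x % g₁ = X % g₁ := by
      refine Nat.ModEq.cancel_left_of_coprime c₁ ((ZMod.natCast_eq_natCast_iff _ _ _).mp ?_)
      have := congrArg (Nat.cast : ℕ → ZMod g₁) (h.trans hXYZ.symm)
      simpa using this
    have hy : y % g₂ = Y % g₂ := by
      refine Nat.ModEq.cancel_left_of_coprime c₂ ((ZMod.natCast_eq_natCast_iff _ _ _).mp ?_)
      have := congrArg (Nat.cast : ℕ → ZMod g₂) (h.trans hXYZ.symm)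
      simpa using this
    have hz : z % g₃ = Z % g₃ := by
      refine Nat.ModEq.cancel_left_of_coprime c₃ ((ZMod.natCast_eq_natCast_iff _ _ _).mp ?_)
      have := congrArg (Nat.cast : ℕ → ZMod g₃) (h.trans hXYZ.symm)
      simpa using this
    have ex := Nat.mod_add_div x g₁
    have ey := Nat.mod_add_div y g₂
    have ez := Nat.mod_add_div z g₃
    rw [hx] at ex
    rw [hy] at ey
    rw [hz] at ez
    refine ⟨(x / g₁, y / g₂, z / g₃), ?_, by simp only [ex, ey, ez]⟩
    simp only [Set.mem_ofPred_eq]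
    refine Nat.eq_of_mul_eq_mul_left hpos ?_
    have h' := h.trans hXYZ.symm
    clear hx hy hz h hXYZ hn
    generalize X / g₁ = X', X % g₁ = x₀, x / g₁ = x' at *
    generalize Y / g₂ = Y', Y % g₂ = y₀, y / g₂ = y' at *
    generalize Z / g₃ = Z', Z % g₃ = z₀, z / g₃ = z' at *
    subst eX eY eZ ex ey ez
    zify at h' ⊢
    linear_combination h'

/-- Factorization of three coefficients without common factor through their pairwise gcds. -/
theorem eq_div_gcd_mul_gcd (a b c : ℕ) (ha : 0 < a) (h : Nat.gcd (Nat.gcd a b) c = 1) :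
    a = a / (Nat.gcd c a * Nat.gcd a b) * (Nat.gcd c a * Nat.gcd a b) ∧
      0 < a / (Nat.gcd c a * Nat.gcd a b) ∧ Nat.Coprime (Nat.gcd b c) a := by
  have hco : Nat.Coprime (Nat.gcd c a) (Nat.gcd a b) := by
    refine Nat.dvd_one.mp (h ▸ Nat.dvd_gcd (Nat.gcd_dvd_right _ _) ?_)
    exact (Nat.gcd_dvd_left _ _).trans (Nat.gcd_dvd_left _ _)
  have hdvd := hco.mul_dvd_of_dvd_of_dvd (Nat.gcd_dvd_right c a) (Nat.gcd_dvd_left a b)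
  refine ⟨(Nat.div_mul_cancel hdvd).symm, Nat.div_pos (Nat.le_of_dvd ha hdvd)
    (Nat.pos_of_dvd_of_pos hdvd ha), ?_⟩
  rw [Nat.Coprime, ← h, Nat.gcd_comm, ← Nat.gcd_assoc]

theorem coprime_of_gcd_mul_mul_eq {A B g₁ g₂ g₃ : ℕ} (h₃ : 0 < g₃)
    (h : g₃ = Nat.gcd (A * (g₂ * g₃)) (B * (g₃ * g₁))) : Nat.Coprime A B := by
  have e : Nat.gcd (A * (g₂ * g₃)) (B * (g₃ * g₁)) = g₃ * Nat.gcd (A * g₂) (B * g₁) := by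
    rw [← Nat.gcd_mul_left]
    congr 1 <;> ring
  rw [e] at h
  have h1 : Nat.Coprime (A * g₂) (B * g₁) :=
    Nat.eq_of_mul_eq_mul_left h₃ (by rw [mul_one]; exact h.symm)
  exact h1.coprime_mul_right.coprime_mul_right_right

theorem stmt_14 (a b c : ℕ)
    (ha : 0 < a) (hb : 0 < b) (hc : 0 < c)
    (habc : Nat.gcd (Nat.gcd a b) c = 1)
    (g1 g2 g3 : ℕ) (hg1 : g1 = Nat.gcd b c) (hg2 : g2 = Nat.gcd c a)
    (hg3 : g3 = Nat.gcd a b)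
    (A B C : ℕ) (hA : A = a / (g2 * g3)) (hB : B = b / (g3 * g1))
    (hC : C = c / (g1 * g2))
    (α β : ℝ) (hα : α = ((A : ℝ) + B + C) / 2) (hβ : β = 2 * A * B * C)
    (M : ℤ) (hM : M = ⌊((2 * α * β - 1) ^ 2 - 4 * α ^ 2) / (4 * β) + α⌋ + 1)
    (k : ℕ)
    (γ δ : ℤ)
    (hγ : γ = ⌊Real.sqrt (β * ((k : ℝ) + α) + α ^ 2) - α⌋)
    (hδ : δ = ⌊Real.sqrt (β * ((k : ℝ) - α) + α ^ 2) - α⌋)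
    (hk : M ≤ (k : ℤ)) (hγδ : γ = δ) :
    {n : ℕ | numSol a b c n = k} = ∅ := by
 
  rw [Set.eq_empty_iff_forall_notMem]
  intro n hn
  simp only [Set.mem_ofPred_eq] at hn
  obtain ⟨ea, hA0, co1⟩ := eq_div_gcd_mul_gcd a b c ha habc
  obtain ⟨eb, hB0, co2⟩ := eq_div_gcd_mul_gcd b c a hb
    (by rw [← habc, Nat.gcd_comm, Nat.gcd_assoc])
  obtain ⟨ec, hC0, co3⟩ := eq_div_gcd_mul_gcd c a b hc
    (by rw [← habc, Nat.gcd_assoc, Nat.gcd_comm])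
  rw [← hg2, ← hg3, ← hA] at ea hA0
  rw [← hg3, ← hg1, ← hB] at eb hB0
  rw [← hg1, ← hg2, ← hC] at ec hC0
  rw [← hg1] at co1
  rw [← hg2] at co2
  rw [← hg3] at co3
  have hg1' : 0 < g1 := hg1 ▸ Nat.gcd_pos_of_pos_left _ hb
  have hg2' : 0 < g2 := hg2 ▸ Nat.gcd_pos_of_pos_left _ hc
  have hg3' : 0 < g3 := hg3 ▸ Nat.gcd_pos_of_pos_left _ ha
  clear hA hB hC
  have hA1 : (1 : ℝ) ≤ A := by exact_mod_cast hA0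
  have hB1 : (1 : ℝ) ≤ B := by exact_mod_cast hB0
  have hC1 : (1 : ℝ) ≤ C := by exact_mod_cast hC0
  have hα1 : 3 / 2 ≤ α := by rw [hα]; linarith
  have hβ2 : 2 ≤ β := by
    have := one_le_mul_of_one_le_of_one_le (one_le_mul_of_one_le_of_one_le hA1 hB1) hC1
    rw [hβ]
    linarith
  have hk0 : k ≠ 0 := by
    have h1 : 0 ≤ ((2 * α * β - 1) ^ 2 - 4 * α ^ 2) / (4 * β) + α := by
      have : 2 * α ≤ 2 * α * β - 1 := by nlinarith
      have : 0 ≤ (2 * α * β - 1) ^ 2 - 4 * α ^ 2 := by nlinarith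
      positivity
    have := Int.floor_nonneg.mpr h1
    omega
  have hAB : Nat.Coprime A B := coprime_of_gcd_mul_mul_eq hg3' (by rw [← ea, ← eb]; exact hg3)
  have hBC : Nat.Coprime B C := coprime_of_gcd_mul_mul_eq hg1' (by rw [← eb, ← ec]; exact hg1)
  have hCA : Nat.Coprime C A := coprime_of_gcd_mul_mul_eq hg2' (by rw [← ec, ← ea]; exact hg2)
  obtain ⟨m, hm⟩ : ∃ m, numSol A B C m = k := by
    have := exists_numSol_mul_eq A B C g1 g2 g3 n hg1' hg2' hg3' (ea ▸ co1) (eb ▸ co2) (ec ▸ co3)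
    rw [← ea, ← eb, ← ec, hn] at this
    exact this hk0
  have hbound := abs_numSol_sub_lt A B C m hA0 hB0 hC0 hAB hCA hBC.symm
  rw [hm, abs_lt, ← hβ, show (A : ℝ) + B + C = 2 * α by rw [hα]; ring,
    show (A : ℝ) * B * C * (2 * α) = α * β by rw [hβ]; ring] at hbound
  obtain ⟨hlo, hup⟩ := hbound
  have hmγ : (m : ℤ) ≤ γ := by
    rw [hγ, Int.le_floor, Int.cast_natCast, le_sub_iff_add_le]
    exact Real.le_sqrt_of_sq_le (by nlinarith)
  rw [hγδ, hδ, Int.le_floor, Int.cast_natCast, le_sub_iff_add_le,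
    Real.le_sqrt' (by positivity)] at hmγ
  nlinarith
end
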